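/- For any complex parameters α_0,…,α_5 with α_0+α_1+α_2+α_3+α_4+α_5 = 1, there is no rational solution (f_0,…,f_5) of A_5(α_0,…,α_5) such that for some i ∈ {0,…,5}, f_i, f_{i+1}, f_{i+3} have a pole at t=∞ and f_{i+2}, f_{i+4}, f_{i+5} are holomorphic at t=∞. -/

import Mathlib

open Filter Topology Polynomial

noncomputable section

/-- Evaluation of a complex rational function at a point (junk value where the
reduced denominator vanishes). -/
def evalR (f : RatFunc ℂ) (t : ℂ) : ℂ := RatFunc.eval (RingHom.id ℂ) t f

/-- `f` is defined at `t`: the reduced denominator does not vanish at `t`. -/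
def DefinedAt (f : RatFunc ℂ) (t : ℂ) : Prop := Polynomial.eval t (RatFunc.denom f) ≠ 0

/-- `(f 0, …, f 5)` is a rational solution of the `A₅⁽¹⁾` Painlevé system `A₅(α)`:
the two constraints hold identically as rational functions, and the six ODEs hold at
every point where all six components are defined.  (Indices are taken in `Fin 6`,
i.e. modulo `6`.) -/
def IsA5Solution (α : Fin 6 → ℂ) (f : Fin 6 → RatFunc ℂ) : Prop :=
  f 0 + f 2 + f 4 = RatFunc.X ∧
  f 1 + f 3 + f 5 = RatFunc.X ∧
  ∀ t : ℂ, (∀ j : Fin 6, DefinedAt (f j) t) → ∀ i : Fin 6,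
    t / 2 * deriv (evalR (f i)) t =
      evalR (f i) t *
        (evalR (f (i + 1)) t * evalR (f (i + 2)) t
          + evalR (f (i + 1)) t * evalR (f (i + 4)) t
          + evalR (f (i + 3)) t * evalR (f (i + 4)) t
          - evalR (f (i + 2)) t * evalR (f (i + 3)) t
          - evalR (f (i + 2)) t * evalR (f (i + 5)) t
          - evalR (f (i + 4)) t * evalR (f (i + 5)) t)
      + (1 / 2 - α (i + 2) - α (i + 4)) * evalR (f i) t
      + α i * (evalR (f (i + 2)) t + evalR (f (i + 4)) t)

/-- `f` has a pole at `t = ∞`: `‖f t‖ → ∞` as `‖t‖ → ∞`. -/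
def PoleAtInfty (f : RatFunc ℂ) : Prop :=
  Tendsto (fun t => ‖evalR f t‖) (Bornology.cobounded ℂ) atTop

/-- `f` is holomorphic at `t = ∞`: `f` is bounded as `‖t‖ → ∞`. -/
def HoloAtInfty (f : RatFunc ℂ) : Prop :=
  IsBoundedUnder (· ≤ ·) (Bornology.cobounded ℂ) fun t => ‖evalR f t‖

/-- `f` has a pole at `c ∈ ℂ`: `‖f t‖ → ∞` as `t → c`. -/
def PoleAt (f : RatFunc ℂ) (c : ℂ) : Prop :=
  Tendsto (fun t => ‖evalR f t‖) (𝓝[≠] c) atTop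

/-- `f` is regular at `c ∈ ℂ`: it extends continuously to `c`. -/
def RegularAt (f : RatFunc ℂ) (c : ℂ) : Prop :=
  ∃ L : ℂ, Tendsto (fun t => evalR f t) (𝓝[≠] c) (𝓝 L)

/-- `z` is an integer. -/
def IsInt (z : ℂ) : Prop := ∃ n : ℤ, z = (n : ℂ)

/-- `z` is an even integer. -/
def IsEvenInt (z : ℂ) : Prop := ∃ n : ℤ, z = 2 * (n : ℂ)

/-- A tuple of rational functions has pole configuration of Type A at `t = ∞`. -/
def TypeA (f : Fin 6 → RatFunc ℂ) : Prop :=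
  ∃ i : Fin 6,
    (PoleAtInfty (f i) ∧ PoleAtInfty (f (i + 1)) ∧ HoloAtInfty (f (i + 2)) ∧
      HoloAtInfty (f (i + 3)) ∧ HoloAtInfty (f (i + 4)) ∧ HoloAtInfty (f (i + 5))) ∨
    (PoleAtInfty (f i) ∧ PoleAtInfty (f (i + 3)) ∧ HoloAtInfty (f (i + 1)) ∧
      HoloAtInfty (f (i + 2)) ∧ HoloAtInfty (f (i + 4)) ∧ HoloAtInfty (f (i + 5))) ∨
    (PoleAtInfty (f i) ∧ PoleAtInfty (f (i + 1)) ∧ PoleAtInfty (f (i + 2)) ∧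
      PoleAtInfty (f (i + 4)) ∧ HoloAtInfty (f (i + 3)) ∧ HoloAtInfty (f (i + 5)))

/-- A tuple of rational functions has pole configuration of Type B at `t = ∞`. -/
def TypeB (f : Fin 6 → RatFunc ℂ) : Prop :=
  ∃ i : Fin 6,
    PoleAtInfty (f i) ∧ PoleAtInfty (f (i + 1)) ∧ PoleAtInfty (f (i + 2)) ∧
    PoleAtInfty (f (i + 3)) ∧ HoloAtInfty (f (i + 4)) ∧ HoloAtInfty (f (i + 5))


/-- A rational function is defined at every point close enough to infinity. -/
lemma eventually_definedAt (f : RatFunc ℂ) :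
    ∀ᶠ t in Bornology.cobounded ℂ, DefinedAt f t := by
  have hfin : {t : ℂ | f.denom.IsRoot t}.Finite :=
    Polynomial.finite_setOfPred_isRoot f.denom_ne_zero
  exact hfin.isBounded

/-- The logarithmic derivative of a nonzero complex polynomial vanishes at infinity. -/
lemma tendsto_derivative_div_cobounded {p : ℂ[X]} (hp : p ≠ 0) :
    Tendsto (fun t => p.derivative.eval t / p.eval t) (Bornology.cobounded ℂ) (𝓝 0) := by
  have hroot : ∀ᶠ t in Bornology.cobounded ℂ, p.eval t ≠ 0 :=
    (Polynomial.finite_setOfPred_isRoot hp).isBounded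
  have hsum : Tendsto (fun t : ℂ => (p.roots.map fun z => 1 / (t - z)).sum)
      (Bornology.cobounded ℂ) (𝓝 (p.roots.map fun _ => (0 : ℂ)).sum) := by
    refine tendsto_multiset_sum _ fun z _ => ?_
    simp only [one_div]
    exact tendsto_inv₀_cobounded.comp (tendsto_sub_const_cobounded z)
  simp only [Multiset.map_const', Multiset.sum_replicate, smul_zero] at hsum
  refine hsum.congr' ?_
  filter_upwards [hroot] with t ht
  exact ((IsAlgClosed.splits p).eval_derivative_div_eval_of_ne_zero ht).symm

/-- The logarithmic derivative of a nonzero rational function vanishes at infinity. -/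
lemma tendsto_logDeriv_evalR_cobounded {f : RatFunc ℂ} (hf : f ≠ 0) :
    Tendsto (fun t => logDeriv (evalR f) t) (Bornology.cobounded ℂ) (𝓝 0) := by
  have hnum : f.num ≠ 0 := RatFunc.num_ne_zero hf
  have hroot : ∀ᶠ t in Bornology.cobounded ℂ, f.num.eval t ≠ 0 :=
    (Polynomial.finite_setOfPred_isRoot hnum).isBounded
  have hlim := (tendsto_derivative_div_cobounded hnum).sub
    (tendsto_derivative_div_cobounded f.denom_ne_zero)
  rw [sub_zero] at hlim
  refine hlim.congr' ?_
  filter_upwards [hroot, eventually_definedAt f] with t ht hd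
  have hquot : evalR f = fun x => f.num.eval x / f.denom.eval x := by
    ext x
    simp [evalR, RatFunc.eval, Polynomial.eval₂_id]
  rw [hquot, logDeriv_div (f := fun x => f.num.eval x) (g := fun x => f.denom.eval x) t ht hd
    f.num.differentiableAt f.denom.differentiableAt]
  simp [logDeriv_apply]

lemma PoleAtInfty.ne_zero {f : RatFunc ℂ} (hf : PoleAtInfty f) : f ≠ 0 := by
  rintro rfl
  have h : Tendsto (fun _ : ℂ => (0 : ℝ)) (Bornology.cobounded ℂ) atTop := by
    simpa [PoleAtInfty, evalR] using hf
  exact not_tendsto_const_atTop _ _ h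

lemma PoleAtInfty.tendsto_cobounded {f : RatFunc ℂ} (hf : PoleAtInfty f) :
    Tendsto (evalR f) (Bornology.cobounded ℂ) (Bornology.cobounded ℂ) :=
  tendsto_norm_atTop_iff_cobounded.mp hf

lemma PoleAtInfty.tendsto_inv {f : RatFunc ℂ} (hf : PoleAtInfty f) :
    Tendsto (fun t => (evalR f t)⁻¹) (Bornology.cobounded ℂ) (𝓝 0) :=
  tendsto_inv₀_cobounded.comp hf.tendsto_cobounded

lemma PoleAtInfty.eventually_ne_zero {f : RatFunc ℂ} (hf : PoleAtInfty f) :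
    ∀ᶠ t in Bornology.cobounded ℂ, evalR f t ≠ 0 :=
  hf.tendsto_cobounded.eventually (Bornology.eventually_ne_cobounded 0)

lemma HoloAtInfty.tendsto_mul_zero {f : RatFunc ℂ} (hf : HoloAtInfty f) {g : ℂ → ℂ}
    (hg : Tendsto g (Bornology.cobounded ℂ) (𝓝 0)) :
    Tendsto (fun t => evalR f t * g t) (Bornology.cobounded ℂ) (𝓝 0) :=
  isBoundedUnder_le_mul_tendsto_zero hf hg

/-- An identity `f + g + h = X` of rational functions holds pointwise near infinity. -/
lemma eventually_evalR_add_add {f g h : RatFunc ℂ} (hX : f + g + h = RatFunc.X) :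
    ∀ᶠ t in Bornology.cobounded ℂ, evalR f t + evalR g t + evalR h t = t := by
  filter_upwards [eventually_definedAt f, eventually_definedAt g, eventually_definedAt h,
    eventually_definedAt (f + g)] with t hf hg hh hfg
  simp only [DefinedAt, ← Polynomial.eval₂_id] at hf hg hh hfg
  simp only [evalR]
  rw [← RatFunc.eval_add (RingHom.id ℂ) t hf hg,
    ← RatFunc.eval_add (RingHom.id ℂ) t hfg hh, hX, RatFunc.eval_X]

/-- Nonexistence of rational solutions with the given pole configuration at `t = ∞`. -/
theorem stmt_5 (α : Fin 6 → ℂ)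
    (hsum : α 0 + α 1 + α 2 + α 3 + α 4 + α 5 = 1) :
    ¬ ∃ (f : Fin 6 → RatFunc ℂ) (i : Fin 6), IsA5Solution α f ∧
      PoleAtInfty (f i) ∧
      PoleAtInfty (f (i + 1)) ∧
      PoleAtInfty (f (i + 3)) ∧
      HoloAtInfty (f (i + 2)) ∧
      HoloAtInfty (f (i + 4)) ∧
      HoloAtInfty (f (i + 5)) := by
  rintro ⟨f, i, ⟨heven, hodd, hode⟩, -, h1, h3, h2, h4, h5⟩
  have hX : f i + f (i + 2) + f (i + 4) = RatFunc.X := by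
    fin_cases i
    · exact heven
    · exact hodd
    · rw [← heven]; change f 2 + f 4 + f 0 = _; ring
    · rw [← hodd]; change f 3 + f 5 + f 1 = _; ring
    · rw [← heven]; change f 4 + f 0 + f 2 = _; ring
    · rw [← hodd]; change f 5 + f 1 + f 3 = _; ring
  have hτ : Tendsto (fun t : ℂ => t⁻¹) (Bornology.cobounded ℂ) (𝓝 0) := tendsto_inv₀_cobounded
  have hr := h1.tendsto_inv
  have hs := h3.tendsto_inv
  have hu2 := h2.tendsto_mul_zero hτ
  have hu4 := h4.tendsto_mul_zero hτ
  have hw := h5.tendsto_mul_zero hs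
  have hL := tendsto_logDeriv_evalR_cobounded h1.ne_zero
  -- The equation for `f (i + 1)`, divided by `t * f (i + 1) * f (i + 3)`, has every term
  -- but one tending to zero.
  have hlim := ((((((hu2.add (hu2.mul hw)).add (hu4.mul hw)).add hu2).sub
    (hw.mul ((hu2.const_sub 1).sub hu4))).add
    ((hs.mul hτ).const_mul (1 / 2 - α (i + 3) - α (i + 5)))).add
    (((hr.mul hτ).mul (hw.const_add 1)).const_mul (α (i + 1)))).sub ((hL.mul hs).div_const 2)
  simp only [mul_zero, zero_mul, add_zero, sub_zero, zero_div] at hlim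
  refine one_ne_zero (tendsto_nhds_unique (tendsto_const_nhds.congr' ?_) hlim)
  filter_upwards [h1.eventually_ne_zero, h3.eventually_ne_zero,
    Bornology.eventually_ne_cobounded (0 : ℂ), eventually_evalR_add_add hX,
    eventually_all.mpr fun j => eventually_definedAt (f j)] with t n1 n3 nt hsumt hdef
  have hE := hode t hdef (i + 1)
  have e5 : i + 1 + 5 = i := by rw [add_assoc]; exact add_zero i
  simp only [e5, add_assoc i 1, show (1 + 1 : Fin 6) = 2 from rfl,
    show (1 + 2 : Fin 6) = 3 from rfl, show (1 + 3 : Fin 6) = 4 from rfl,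
    show (1 + 4 : Fin 6) = 5 from rfl] at hE
  have e0 : evalR (f i) t = t - evalR (f (i + 2)) t - evalR (f (i + 4)) t := by
    linear_combination hsumt
  rw [e0] at hE
  rw [logDeriv_apply]
  generalize deriv (evalR (f (i + 1))) t = D at *
  field_simp
  linear_combination 2 * hE
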